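/- Let C₁, …, C_L be positive semi-definite complex matrices (all of the same size n × n), and for each i ∈ {1, …, L} let the variables V_{C_i} range over unitary matrices commuting with C_i. Then for real 1 ≤ q ≤ p, the maximum over such unitaries satisfies max_{V_{C_1},…,V_{C_L}} ‖C₁^{1/p} V_{C_1} ⋯ C_L^{1/p} V_{C_L}‖_p^p ≤ max_{W_{C_1},…,W_{C_L}} ‖C₁^{1/q} W_{C_1} ⋯ C_L^{1/q} W_{C_L}‖_q^q; i.e., the quantity max_{V_{C_1},…,V_{C_L}} ‖C₁^{1/p} V_{C_1} ⋯ C_L^{1/p} V_{C_L}‖_p^p is monotone non-increasing with respect to p for p ≥ 1. -/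

import Mathlib

noncomputable section

open Matrix
open scoped ENNReal ComplexOrder

/-- Functional calculus of a Hermitian complex matrix applied with a complex-valued
function of its (real) eigenvalues. Returns `0` if the matrix is not Hermitian. -/
def hermFC {n : Type*} [Fintype n] [DecidableEq n] (A : Matrix n n ℂ) (f : ℝ → ℂ) :
    Matrix n n ℂ :=
  if hA : A.IsHermitian then
    (hA.eigenvectorUnitary : Matrix n n ℂ) * Matrix.diagonal (f ∘ hA.eigenvalues) *
      (star hA.eigenvectorUnitary : Matrix n n ℂ)
  else 0

/-- Complex power `A ^ z` of a positive semi-definite matrix, defined by functional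
calculus on eigenvalues, with eigenvalue `0` mapped to `0`. -/
def mpow {n : Type*} [Fintype n] [DecidableEq n] (A : Matrix n n ℂ) (z : ℂ) :
    Matrix n n ℂ :=
  hermFC A (fun x => if x = 0 then 0 else (x : ℂ) ^ z)

/-- The Schatten `p`-norm `(Tr |X|^p)^(1/p)` of a complex matrix, where
`|X|^p = (Xᴴ X)^(p/2)` is given by functional calculus. -/
def schattenNorm {n : Type*} [Fintype n] [DecidableEq n] (p : ℝ) (X : Matrix n n ℂ) : ℝ :=
  ((mpow (Xᴴ * X) ((p / 2 : ℝ) : ℂ)).trace).re ^ (1 / p)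

/-- The operator norm (largest singular value) of a complex matrix. -/
def opNorm {n : Type*} [Fintype n] [DecidableEq n] (X : Matrix n n ℂ) : ℝ :=
  ‖Matrix.toEuclideanCLM (𝕜 := ℂ) X‖

/-- Schatten norm with exponent in `[1,∞]`: the operator norm when `p = ∞`. -/
def schattenNormE {n : Type*} [Fintype n] [DecidableEq n] (p : ℝ≥0∞) (X : Matrix n n ℂ) :
    ℝ :=
  if p = ⊤ then opNorm X else schattenNorm p.toReal X

/-- Matrix logarithm of a Hermitian matrix via functional calculus. -/
def mlog {n : Type*} [Fintype n] [DecidableEq n] (A : Matrix n n ℂ) : Matrix n n ℂ :=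
  hermFC A (fun x => ((Real.log x : ℝ) : ℂ))

/-- Matrix exponential of a Hermitian matrix via functional calculus. -/
def mexp {n : Type*} [Fintype n] [DecidableEq n] (A : Matrix n n ℂ) : Matrix n n ℂ :=
  hermFC A (fun x => ((Real.exp x : ℝ) : ℂ))

/-- `α_θ(t) = sin(πθ)/(2(1-θ)[cosh(πt) - cos(πθ)])`. -/
def alphaW (θ t : ℝ) : ℝ :=
  Real.sin (Real.pi * θ) / (2 * (1 - θ) * (Real.cosh (Real.pi * t) - Real.cos (Real.pi * θ)))

/-- `β_θ(t) = sin(πθ)/(2θ[cosh(πt) + cos(πθ)])`. -/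
def betaW (θ t : ℝ) : ℝ :=
  Real.sin (Real.pi * θ) / (2 * θ * (Real.cosh (Real.pi * t) + Real.cos (Real.pi * θ)))

/-- `β₀(t) = π/(2[cosh(πt) + 1])`. -/
def betaZero (t : ℝ) : ℝ := Real.pi / (2 * (Real.cosh (Real.pi * t) + 1))

section PowerChain

open scoped Matrix.Norms.L2Operator

variable {n : Type*} [Fintype n] [DecidableEq n]

lemma hermFC_def {A : Matrix n n ℂ} (hA : A.IsHermitian) (f : ℝ → ℂ) :
    hermFC A f = (hA.eigenvectorUnitary : Matrix n n ℂ) *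
      Matrix.diagonal (f ∘ hA.eigenvalues) * (hA.eigenvectorUnitary : Matrix n n ℂ)ᴴ := by
  rw [hermFC, dif_pos hA]
  rfl

lemma eigenvectorUnitary_conjTranspose_mul_self {A : Matrix n n ℂ} (hA : A.IsHermitian) :
    (hA.eigenvectorUnitary : Matrix n n ℂ)ᴴ * (hA.eigenvectorUnitary : Matrix n n ℂ) = 1 :=
  Unitary.coe_star_mul_self hA.eigenvectorUnitary

lemma eigenvectorUnitary_mul_conjTranspose_self {A : Matrix n n ℂ} (hA : A.IsHermitian) :
    (hA.eigenvectorUnitary : Matrix n n ℂ) * (hA.eigenvectorUnitary : Matrix n n ℂ)ᴴ = 1 :=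
  Unitary.coe_mul_star_self hA.eigenvectorUnitary

lemma hermFC_mul {A : Matrix n n ℂ} (hA : A.IsHermitian) (f g : ℝ → ℂ) :
    hermFC A f * hermFC A g = hermFC A (fun x => f x * g x) := by
  simp only [hermFC_def hA]
  set U := (hA.eigenvectorUnitary : Matrix n n ℂ)
  have h : Uᴴ * U = 1 := eigenvectorUnitary_conjTranspose_mul_self hA
  calc _ = U * diagonal (f ∘ hA.eigenvalues) * (Uᴴ * U) * diagonal (g ∘ hA.eigenvalues) * Uᴴ := by
        simp only [Matrix.mul_assoc]
    _ = _ := by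
        rw [h, Matrix.mul_one, Matrix.mul_assoc U, diagonal_mul_diagonal]
        rfl

lemma hermFC_conjTranspose {A : Matrix n n ℂ} (hA : A.IsHermitian) (f : ℝ → ℂ) :
    (hermFC A f)ᴴ = hermFC A (fun x => star (f x)) := by
  simp only [hermFC_def hA, conjTranspose_mul, conjTranspose_conjTranspose,
    diagonal_conjTranspose, Matrix.mul_assoc]
  rfl

lemma hermFC_ofReal {A : Matrix n n ℂ} (hA : A.IsHermitian) :
    hermFC A (fun x => (x : ℂ)) = A := by
  rw [hermFC_def hA]
  exact hA.spectral_theorem.symm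

lemma hermFC_one {A : Matrix n n ℂ} (hA : A.IsHermitian) :
    hermFC A (fun _ => 1) = 1 := by
  rw [hermFC_def hA, show ((fun _ => 1 : ℝ → ℂ) ∘ hA.eigenvalues) = fun _ => 1 from rfl,
    diagonal_one, Matrix.mul_one, eigenvectorUnitary_mul_conjTranspose_self]

lemma hermFC_congr {A : Matrix n n ℂ} (hA : A.IsHermitian) {f g : ℝ → ℂ}
    (h : ∀ i, f (hA.eigenvalues i) = g (hA.eigenvalues i)) : hermFC A f = hermFC A g := by
  rw [hermFC_def hA, hermFC_def hA, show f ∘ hA.eigenvalues = g ∘ hA.eigenvalues from funext h]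

lemma hermFC_sub {A : Matrix n n ℂ} (hA : A.IsHermitian) (f g : ℝ → ℂ) :
    hermFC A f - hermFC A g = hermFC A (fun x => f x - g x) := by
  simp only [hermFC_def hA]
  rw [← Matrix.sub_mul, ← Matrix.mul_sub, diagonal_sub]
  rfl

lemma trace_hermFC {A : Matrix n n ℂ} (hA : A.IsHermitian) (f : ℝ → ℂ) :
    (hermFC A f).trace = ∑ i, f (hA.eigenvalues i) := by
  rw [hermFC_def hA, trace_mul_comm, ← Matrix.mul_assoc,
    eigenvectorUnitary_conjTranspose_mul_self, Matrix.one_mul, trace_diagonal]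
  rfl

lemma l2_opNorm_one_le : ‖(1 : Matrix n n ℂ)‖ ≤ 1 := by
  rw [← diagonal_one, l2_opNorm_diagonal, pi_norm_le_iff_of_nonneg zero_le_one]
  simp

lemma l2_opNorm_le_one_of_conjTranspose_mul_self {M : Matrix n n ℂ} (h : ‖Mᴴ * M‖ ≤ 1) :
    ‖M‖ ≤ 1 := by
  rw [l2_opNorm_conjTranspose_mul_self] at h
  nlinarith [norm_nonneg M]

lemma l2_opNorm_le_one_of_mem_unitaryGroup {U : Matrix n n ℂ}
    (hU : U ∈ Matrix.unitaryGroup n ℂ) : ‖U‖ ≤ 1 := by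
  apply l2_opNorm_le_one_of_conjTranspose_mul_self
  rw [← star_eq_conjTranspose, mem_unitaryGroup_iff'.1 hU]
  exact l2_opNorm_one_le

lemma l2_opNorm_mul_le_one {A B : Matrix n n ℂ} (hA : ‖A‖ ≤ 1) (hB : ‖B‖ ≤ 1) :
    ‖A * B‖ ≤ 1 :=
  (norm_mul_le A B).trans (mul_le_one₀ hA (norm_nonneg _) hB)

lemma norm_entry_le_l2_opNorm (M : Matrix n n ℂ) (i j : n) : ‖M i j‖ ≤ ‖M‖ := by
  have h := l2_opNorm_mulVec M (EuclideanSpace.single j (1 : ℂ))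
  rw [PiLp.norm_single, norm_one, mul_one] at h
  refine le_trans ?_ ((PiLp.norm_apply_le _ i).trans h)
  simp

lemma norm_trace_le_l2_opNorm (M : Matrix n n ℂ) : ‖M.trace‖ ≤ Fintype.card n * ‖M‖ := by
  refine (norm_sum_le _ _).trans ?_
  refine (Finset.sum_le_sum fun i _ => norm_entry_le_l2_opNorm M i i).trans ?_
  simp

lemma sum_norm_sq_row_le {M : Matrix n n ℂ} (hM : ‖M‖ ≤ 1) (i : n) :
    ∑ j, ‖M i j‖ ^ 2 ≤ 1 := by
  have h : (M * Mᴴ) i i = ((∑ j, ‖M i j‖ ^ 2 : ℝ) : ℂ) := by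
    rw [Matrix.mul_apply]
    push_cast
    refine Finset.sum_congr rfl fun j _ => ?_
    rw [conjTranspose_apply]
    exact RCLike.mul_conj _
  have h2 := norm_entry_le_l2_opNorm (M * Mᴴ) i i
  rw [h, Complex.norm_real, Real.norm_of_nonneg (by positivity)] at h2
  exact h2.trans (l2_opNorm_mul_le_one hM (by rwa [l2_opNorm_conjTranspose]))

lemma sum_norm_sq_col_le {M : Matrix n n ℂ} (hM : ‖M‖ ≤ 1) (j : n) :
    ∑ i, ‖M i j‖ ^ 2 ≤ 1 := by
  have h := sum_norm_sq_row_le (M := Mᴴ) (by rwa [l2_opNorm_conjTranspose]) j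
  simpa [conjTranspose_apply] using h

lemma l2_opNorm_eigenvectorUnitary_le {A : Matrix n n ℂ} (hA : A.IsHermitian) :
    ‖(hA.eigenvectorUnitary : Matrix n n ℂ)‖ ≤ 1 :=
  l2_opNorm_le_one_of_mem_unitaryGroup hA.eigenvectorUnitary.2

lemma l2_opNorm_eigenvectorUnitary_conjTranspose_le {A : Matrix n n ℂ} (hA : A.IsHermitian) :
    ‖(hA.eigenvectorUnitary : Matrix n n ℂ)ᴴ‖ ≤ 1 := by
  rw [l2_opNorm_conjTranspose]
  exact l2_opNorm_eigenvectorUnitary_le hA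

lemma l2_opNorm_hermFC_le {A : Matrix n n ℂ} (hA : A.IsHermitian) {f : ℝ → ℂ} {c : ℝ}
    (hc : 0 ≤ c) (h : ∀ i, ‖f (hA.eigenvalues i)‖ ≤ c) : ‖hermFC A f‖ ≤ c := by
  have hd : ‖diagonal (f ∘ hA.eigenvalues)‖ ≤ c := by
    rw [l2_opNorm_diagonal, pi_norm_le_iff_of_nonneg hc]
    exact h
  rw [hermFC_def hA]
  calc _ ≤ ‖(hA.eigenvectorUnitary : Matrix n n ℂ)‖ * ‖diagonal (f ∘ hA.eigenvalues)‖ *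
        ‖(hA.eigenvectorUnitary : Matrix n n ℂ)ᴴ‖ := norm_mul₃_le
    _ ≤ 1 * c * 1 := by
        gcongr
        · exact l2_opNorm_eigenvectorUnitary_le hA
        · exact l2_opNorm_eigenvectorUnitary_conjTranspose_le hA
    _ = c := by ring

lemma norm_eigenvalues_le_l2_opNorm {A : Matrix n n ℂ} (hA : A.IsHermitian) (i : n) :
    |hA.eigenvalues i| ≤ ‖A‖ := by
  set U := (hA.eigenvectorUnitary : Matrix n n ℂ) with hU
  have h1 : Uᴴ * U = 1 := eigenvectorUnitary_conjTranspose_mul_self hA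
  have h : diagonal ((fun x : ℝ => (x : ℂ)) ∘ hA.eigenvalues) = Uᴴ * A * U := by
    conv_rhs => rw [← hermFC_ofReal hA, hermFC_def hA, ← hU]
    calc _ = (Uᴴ * U) * diagonal ((fun x : ℝ => (x : ℂ)) ∘ hA.eigenvalues) * (Uᴴ * U) := by
          rw [h1, Matrix.one_mul, Matrix.mul_one]
      _ = _ := by simp only [Matrix.mul_assoc]
  have h2 := norm_entry_le_l2_opNorm (Uᴴ * A * U) i i
  rw [← h, diagonal_apply_eq, Function.comp, Complex.norm_real, Real.norm_eq_abs, h] at h2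
  refine h2.trans (norm_mul₃_le.trans ?_)
  calc _ ≤ 1 * ‖A‖ * 1 := by
        gcongr
        · exact l2_opNorm_eigenvectorUnitary_conjTranspose_le hA
        · exact l2_opNorm_eigenvectorUnitary_le hA
    _ = ‖A‖ := by ring

lemma differentiable_hermFC {A : Matrix n n ℂ} (hA : A.IsHermitian) {g : ℂ → ℝ → ℂ}
    (hg : ∀ x, Differentiable ℂ fun z => g z x) : Differentiable ℂ fun z => hermFC A (g z) := by
  have h : (fun z => hermFC A (g z)) = fun z => ∑ i, g z (hA.eigenvalues i) •
      ((hA.eigenvectorUnitary : Matrix n n ℂ) * single i i 1 *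
        (hA.eigenvectorUnitary : Matrix n n ℂ)ᴴ) := by
    funext z
    rw [hermFC_def hA, ← sum_single_eq_diagonal, Matrix.mul_sum, Matrix.sum_mul]
    refine Finset.sum_congr rfl fun i _ => ?_
    rw [← Matrix.smul_mul, ← Matrix.mul_smul, smul_single, smul_eq_mul, mul_one]
    rfl
  rw [h]
  exact Differentiable.fun_sum fun i _ => (hg _).smul_const _

lemma norm_trace_hermFC_mul_le {A M : Matrix n n ℂ} (hA : A.IsHermitian) (f : ℝ → ℂ)
    (hM : ‖M‖ ≤ 1) : ‖(hermFC A f * M).trace‖ ≤ ∑ i, ‖f (hA.eigenvalues i)‖ := by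
  set U := (hA.eigenvectorUnitary : Matrix n n ℂ) with hU
  have h : (hermFC A f * M).trace = ∑ i, f (hA.eigenvalues i) * (Uᴴ * M * U) i i := by
    rw [hermFC_def hA, ← hU, Matrix.mul_assoc, trace_mul_comm, ← Matrix.mul_assoc,
      trace_mul_comm]
    simp [Matrix.trace, diagonal_mul]
  have hN : ‖Uᴴ * M * U‖ ≤ 1 :=
    l2_opNorm_mul_le_one (l2_opNorm_mul_le_one
      (l2_opNorm_eigenvectorUnitary_conjTranspose_le hA) hM) (l2_opNorm_eigenvectorUnitary_le hA)
  rw [h]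
  refine (norm_sum_le _ _).trans (Finset.sum_le_sum fun i _ => ?_)
  rw [norm_mul]
  exact mul_le_of_le_one_right (norm_nonneg _) ((norm_entry_le_l2_opNorm _ i i).trans hN)

/-- Polar decomposition: `K` is the adjoint of the partial isometry of `X`. -/
lemma exists_polar (X : Matrix n n ℂ) : ∃ K : Matrix n n ℂ, ‖K‖ ≤ 1 ∧
    K * X = hermFC (Xᴴ * X) (fun x => (√x : ℂ)) ∧
    Kᴴ * hermFC (Xᴴ * X) (fun x => (√x : ℂ)) = X := by
  have hA := isHermitian_conjTranspose_mul_self X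
  have hpos := eigenvalues_conjTranspose_mul_self_nonneg X
  set A := Xᴴ * X with hAdef
  set R := hermFC A (fun x => ((√x)⁻¹ : ℂ)) with hR
  have hRR : Rᴴ = R := by
    rw [hR, hermFC_conjTranspose hA]
    refine hermFC_congr hA fun i => ?_
    simp
  have hid (f g : ℝ → ℂ) : hermFC A f * A * hermFC A g = hermFC A (fun x => f x * x * g x) := by
    conv_lhs =>
      enter [1, 2]
      rw [← hermFC_ofReal hA]
    rw [hermFC_mul hA, hermFC_mul hA]
  refine ⟨R * Xᴴ, ?_, ?_, ?_⟩
  · rw [← l2_opNorm_conjTranspose]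
    apply l2_opNorm_le_one_of_conjTranspose_mul_self
    rw [conjTranspose_conjTranspose, conjTranspose_mul, conjTranspose_conjTranspose, hRR,
      show R * Xᴴ * (X * R) = R * A * R by simp only [hAdef, Matrix.mul_assoc], hid]
    refine l2_opNorm_hermFC_le hA zero_le_one fun i => ?_
    have h0 := hpos i
    rcases h0.eq_or_lt with h | h
    · simp [← h]
    · have h2 : (√(hA.eigenvalues i))⁻¹ * hA.eigenvalues i * (√(hA.eigenvalues i))⁻¹ = 1 := by
        have h3 := Real.mul_self_sqrt h0
        have h4 := (Real.sqrt_pos.2 h).ne'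
        field_simp
        nlinarith
      rw [← Complex.ofReal_inv, ← Complex.ofReal_mul, ← Complex.ofReal_mul, h2]
      simp
  · have := hid (fun x => ((√x)⁻¹ : ℂ)) (fun _ => 1)
    rw [hermFC_one hA, Matrix.mul_one, ← hR] at this
    rw [Matrix.mul_assoc, ← hAdef, this]
    refine hermFC_congr hA fun i => ?_
    have h0 := hpos i
    rcases h0.eq_or_lt with h | h
    · simp [← h]
    · have h2 : (√(hA.eigenvalues i))⁻¹ * hA.eigenvalues i = √(hA.eigenvalues i) := by
        have h3 := Real.mul_self_sqrt h0
        have h4 := (Real.sqrt_pos.2 h).ne'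
        field_simp
        nlinarith
      rw [← Complex.ofReal_inv, ← Complex.ofReal_mul, h2, mul_one]
  · rw [conjTranspose_mul, conjTranspose_conjTranspose, hRR, Matrix.mul_assoc, hR, hermFC_mul hA]
    set P := hermFC A (fun x => ((√x)⁻¹ : ℂ) * (√x : ℂ)) with hP
    have hQ : 1 - P = hermFC A (fun x => 1 - ((√x)⁻¹ : ℂ) * (√x : ℂ)) := by
      rw [hP, ← hermFC_sub hA, hermFC_one hA]
    have h : (X * (1 - P))ᴴ * (X * (1 - P)) = 0 := by
      rw [conjTranspose_mul, show (1 - P)ᴴ * Xᴴ * (X * (1 - P)) = (1 - P)ᴴ * A * (1 - P) by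
        simp only [hAdef, Matrix.mul_assoc], hQ, hermFC_conjTranspose hA, hid,
        hermFC_congr hA (g := fun x => (0 : ℂ) * 0), ← hermFC_mul hA]
      · rw [hermFC_def hA]
        simp [Function.comp_def]
      · intro i
        rcases (hpos i).eq_or_lt with h | h
        · simp [← h]
        · have h4 : (√(hA.eigenvalues i) : ℂ) ≠ 0 :=
            Complex.ofReal_ne_zero.2 (Real.sqrt_pos.2 h).ne'
          simp [h4]
    rw [conjTranspose_mul_self_eq_zero, Matrix.mul_sub, Matrix.mul_one, sub_eq_zero] at h
    exact h.symm

lemma schattenNorm_rpow {p : ℝ} (hp : 0 < p) (X : Matrix n n ℂ) :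
    schattenNorm p X ^ p =
      ∑ i, ((isHermitian_conjTranspose_mul_self X).eigenvalues i) ^ (p / 2) := by
  have hA := isHermitian_conjTranspose_mul_self X
  have hpos := eigenvalues_conjTranspose_mul_self_nonneg X
  have h : (mpow (Xᴴ * X) ((p / 2 : ℝ) : ℂ)).trace.re = ∑ i, (hA.eigenvalues i) ^ (p / 2) := by
    rw [mpow, trace_hermFC hA, Complex.re_sum]
    refine Finset.sum_congr rfl fun i _ => ?_
    split_ifs with h0
    · rw [h0, Real.zero_rpow (by positivity), Complex.zero_re]
    · rw [← Complex.ofReal_cpow (hpos i), Complex.ofReal_re]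
  rw [schattenNorm, h, ← Real.rpow_mul (Finset.sum_nonneg fun i _ => Real.rpow_nonneg (hpos i) _),
    one_div_mul_cancel hp.ne', Real.rpow_one]

lemma trace_diagonal_mul_mul_diagonal_mul (d g : n → ℂ) (E F : Matrix n n ℂ) :
    (diagonal d * E * diagonal g * F).trace = ∑ i, ∑ j, d i * E i j * g j * F j i := by
  simp [Matrix.trace, Matrix.mul_apply (M := diagonal d * E * diagonal g), mul_diagonal,
    diagonal_mul]

/-- Hölder's inequality for a double sum weighted by two contractions. -/
lemma norm_trace_diagonal_mul_mul_diagonal_mul_le {E F : Matrix n n ℂ} (hE : ‖E‖ ≤ 1)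
    (hF : ‖F‖ ≤ 1) {q T S : ℝ} {r s : n → ℝ} {d g : n → ℂ} (hq : 1 ≤ q)
    (hr : ∀ i, 0 ≤ r i) (hT : 0 < T) (hrT : ∑ i, r i ≤ T) (hd : ∀ i, ‖d i‖ ≤ r i ^ (1 - 1 / q))
    (hs : ∀ i, 0 ≤ s i) (hS : 0 < S) (hsS : ∑ i, s i ≤ S) (hg : ∀ i, ‖g i‖ ≤ s i ^ (1 / q)) :
    ‖(diagonal d * E * diagonal g * F).trace‖ ≤ T ^ (1 - 1 / q) * S ^ (1 / q) := by
  have hq0 : 0 < q := by linarith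
  have hq1 : 0 ≤ 1 - 1 / q := by
    rw [sub_nonneg, div_le_one hq0]; exact hq
  have hq2 : 0 ≤ 1 / q := by positivity
  set w : n → n → ℝ := fun i j => (‖E i j‖ ^ 2 + ‖F j i‖ ^ 2) / 2 with hw
  have hw0 i j : 0 ≤ w i j := by positivity
  have hwi i : ∑ j, w i j ≤ 1 := by
    simp only [hw]
    rw [← Finset.sum_div, Finset.sum_add_distrib]
    linarith [sum_norm_sq_row_le hE i, sum_norm_sq_col_le hF i]
  have hwj j : ∑ i, w i j ≤ 1 := by
    simp only [hw]
    rw [← Finset.sum_div, Finset.sum_add_distrib]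
    linarith [sum_norm_sq_col_le hE j, sum_norm_sq_row_le hF j]
  set c := T ^ (1 - 1 / q) * S ^ (1 / q) with hc
  have hc0 : 0 < c := by positivity
  have hterm i j : ‖d i * E i j * g j * F j i‖ ≤
      c * (w i j * ((1 - 1 / q) * (r i / T) + 1 / q * (s j / S))) := by
    have hY := Real.geom_mean_le_arith_mean2_weighted hq1 hq2
      (div_nonneg (hr i) hT.le) (div_nonneg (hs j) hS.le) (by ring)
    rw [Real.div_rpow (hr i) hT.le, Real.div_rpow (hs j) hS.le, div_mul_div_comm, ← hc,
      div_le_iff₀ hc0] at hY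
    rw [norm_mul, norm_mul, norm_mul]
    have hEF : ‖E i j‖ * ‖F j i‖ ≤ w i j := by
      simp only [hw]
      nlinarith [sq_nonneg (‖E i j‖ - ‖F j i‖)]
    calc _ = (‖E i j‖ * ‖F j i‖) * (‖d i‖ * ‖g j‖) := by ring
      _ ≤ w i j * (r i ^ (1 - 1 / q) * s j ^ (1 / q)) :=
          mul_le_mul hEF (mul_le_mul (hd i) (hg j) (norm_nonneg _) (Real.rpow_nonneg (hr i) _))
            (by positivity) (hw0 i j)
      _ ≤ w i j * (((1 - 1 / q) * (r i / T) + 1 / q * (s j / S)) * c) :=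
          mul_le_mul_of_nonneg_left hY (hw0 i j)
      _ = _ := by ring
  have h1 : ∑ i, ∑ j, w i j * (r i / T) ≤ 1 := by
    calc _ = ∑ i, (∑ j, w i j) * (r i / T) := by simp only [Finset.sum_mul]
      _ ≤ ∑ i, 1 * (r i / T) := Finset.sum_le_sum fun i _ =>
          mul_le_mul_of_nonneg_right (hwi i) (div_nonneg (hr i) hT.le)
      _ = (∑ i, r i) / T := by simp only [one_mul, Finset.sum_div]
      _ ≤ 1 := (div_le_one hT).2 hrT
  have h2 : ∑ i, ∑ j, w i j * (s j / S) ≤ 1 := by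
    rw [Finset.sum_comm]
    calc _ = ∑ j, (∑ i, w i j) * (s j / S) := by simp only [Finset.sum_mul]
      _ ≤ ∑ j, 1 * (s j / S) := Finset.sum_le_sum fun j _ =>
          mul_le_mul_of_nonneg_right (hwj j) (div_nonneg (hs j) hS.le)
      _ = (∑ j, s j) / S := by simp only [one_mul, Finset.sum_div]
      _ ≤ 1 := (div_le_one hS).2 hsS
  rw [trace_diagonal_mul_mul_diagonal_mul]
  calc _ ≤ ∑ i, ∑ j, ‖d i * E i j * g j * F j i‖ :=
        (norm_sum_le _ _).trans (Finset.sum_le_sum fun i _ => norm_sum_le _ _)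
    _ ≤ ∑ i, ∑ j, c * (w i j * ((1 - 1 / q) * (r i / T) + 1 / q * (s j / S))) :=
        Finset.sum_le_sum fun i _ => Finset.sum_le_sum fun j _ => hterm i j
    _ = c * ((1 - 1 / q) * ∑ i, ∑ j, w i j * (r i / T) +
          1 / q * ∑ i, ∑ j, w i j * (s j / S)) := by
        simp only [Finset.mul_sum, ← Finset.sum_add_distrib]
        refine Finset.sum_congr rfl fun i _ => Finset.sum_congr rfl fun j _ => ?_
        ring
    _ ≤ c * ((1 - 1 / q) * 1 + 1 / q * 1) := by gcongr
    _ = c := by ring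

lemma exists_hermFC_eq {A : Matrix n n ℂ} (hA : A.IsHermitian) :
    ∃ U : Matrix n n ℂ, ‖U‖ ≤ 1 ∧ ‖Uᴴ‖ ≤ 1 ∧
      ∀ f, hermFC A f = U * diagonal (f ∘ hA.eigenvalues) * Uᴴ :=
  ⟨_, l2_opNorm_eigenvectorUnitary_le hA, l2_opNorm_eigenvectorUnitary_conjTranspose_le hA,
    hermFC_def hA⟩

/-- Hölder's inequality for the trace pairing. -/
lemma norm_trace_hermFC_mul_mul_le_rpow {A M X : Matrix n n ℂ} (hA : A.IsHermitian) (f : ℝ → ℂ)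
    (hM : ‖M‖ ≤ 1) {q T S : ℝ} {r : n → ℝ} (hq : 1 ≤ q) (hr : ∀ i, 0 ≤ r i) (hT : 0 < T)
    (hrT : ∑ i, r i ≤ T) (hf : ∀ i, ‖f (hA.eigenvalues i)‖ ≤ r i ^ (1 - 1 / q)) (hS : 0 < S)
    (hX : schattenNorm q X ^ q ≤ S) :
    ‖(hermFC A f * M * X).trace‖ ≤ T ^ (1 - 1 / q) * S ^ (1 / q) := by
  have hq0 : 0 < q := by linarith
  obtain ⟨K, hK, -, hKX⟩ := exists_polar X
  have hB := isHermitian_conjTranspose_mul_self X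
  have hpos := eigenvalues_conjTranspose_mul_self_nonneg X
  rw [schattenNorm_rpow hq0] at hX
  obtain ⟨U, hU, hU', hUA⟩ := exists_hermFC_eq hA
  obtain ⟨W, hW, hW', hWB⟩ := exists_hermFC_eq hB
  rw [← l2_opNorm_conjTranspose] at hK
  have hE : ‖Uᴴ * M * Kᴴ * W‖ ≤ 1 := l2_opNorm_mul_le_one (l2_opNorm_mul_le_one
    (l2_opNorm_mul_le_one hU' hM) hK) hW
  have key := norm_trace_diagonal_mul_mul_diagonal_mul_le hE (l2_opNorm_mul_le_one hW' hU) hq hr hT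
    hrT hf (fun i => Real.rpow_nonneg (hpos i) (q / 2)) hS hX
    (g := (fun x : ℝ => (√x : ℂ)) ∘ hB.eigenvalues) (fun i => by
      rw [← Real.rpow_mul (hpos i), show q / 2 * (1 / q) = 1 / 2 by field_simp,
        ← Real.sqrt_eq_rpow, Function.comp_apply, Complex.norm_real,
        Real.norm_of_nonneg (Real.sqrt_nonneg _)])
  have htr : (hermFC A f * M * X).trace = (diagonal (f ∘ hA.eigenvalues) * (Uᴴ * M * Kᴴ * W) *
      diagonal ((fun x : ℝ => (√x : ℂ)) ∘ hB.eigenvalues) * (Wᴴ * U)).trace := by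
    conv_lhs => rw [← hKX, hUA, hWB]
    rw [← Matrix.mul_assoc _ Wᴴ U, trace_mul_comm _ U]
    simp only [Matrix.mul_assoc]
  rw [htr]
  exact key

lemma mpow_differentiable {A : Matrix n n ℂ} (hA : A.IsHermitian) {g : ℂ → ℂ}
    (hg : Differentiable ℂ g) : Differentiable ℂ fun z => mpow A (g z) := by
  refine differentiable_hermFC hA fun x => ?_
  by_cases hx : x = 0
  · simp [hx]
  · simp only [hx, if_false]
    exact hg.const_cpow (Or.inl (Complex.ofReal_ne_zero.2 hx))

lemma norm_ite_cpow_le {x : ℝ} (hx : 0 ≤ x) (w : ℂ) :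
    ‖(if x = 0 then 0 else (x : ℂ) ^ w)‖ ≤ x ^ w.re := by
  split_ifs with h
  · rw [norm_zero]
    exact Real.rpow_nonneg hx _
  · rw [Complex.norm_cpow_eq_rpow_re_of_pos (hx.lt_of_ne' h)]

lemma exists_l2_opNorm_mpow_le {A : Matrix n n ℂ} (hA : A.PosSemidef) (a : ℝ) :
    ∃ B, 0 ≤ B ∧ ∀ w : ℂ, 0 ≤ w.re → w.re ≤ a → ‖mpow A w‖ ≤ B := by
  have h0 : 0 ≤ ∑ i, hA.1.eigenvalues i := Finset.sum_nonneg fun i _ => hA.eigenvalues_nonneg i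
  refine ⟨(1 + ∑ i, hA.1.eigenvalues i) ^ a, by positivity, fun w hw hwa => ?_⟩
  refine l2_opNorm_hermFC_le hA.1 (by positivity) fun i => ?_
  refine (norm_ite_cpow_le (hA.eigenvalues_nonneg i) w).trans ?_
  have h1 : hA.1.eigenvalues i ≤ 1 + ∑ i, hA.1.eigenvalues i := by
    have := Finset.single_le_sum (fun i _ => hA.eigenvalues_nonneg i) (Finset.mem_univ i)
    linarith
  exact (Real.rpow_le_rpow (hA.eigenvalues_nonneg i) h1 hw).trans
    (Real.rpow_le_rpow_of_exponent_le (by linarith) hwa)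

lemma l2_opNorm_prod_ofFn_le {L : ℕ} (M : Fin L → Matrix n n ℂ) (b : Fin L → ℝ)
    (h : ∀ i, ‖M i‖ ≤ b i) : ‖(List.ofFn M).prod‖ ≤ ∏ i, b i := by
  induction L with
  | zero => simpa using l2_opNorm_one_le
  | succ L ih =>
    rw [List.ofFn_succ, List.prod_cons, Fin.prod_univ_succ]
    exact (norm_mul_le _ _).trans (mul_le_mul (h 0) (ih _ _ fun i => h i.succ) (norm_nonneg _)
      ((norm_nonneg _).trans (h 0)))

lemma differentiable_prod_ofFn {L : ℕ} (M : Fin L → ℂ → Matrix n n ℂ)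
    (h : ∀ i, Differentiable ℂ (M i)) :
    Differentiable ℂ fun z => (List.ofFn fun i => M i z).prod := by
  induction L with
  | zero => simp
  | succ L ih =>
    simp only [List.ofFn_succ, List.prod_cons]
    exact (h 0).mul (ih _ fun i => h i.succ)

/-- Along a vertical line, `C ^ (s + it)` is `C ^ s` times a unitary commuting with `C`. -/
lemma exists_mpow_eq_mul_unitary {A : Matrix n n ℂ} (hA : A.PosSemidef) (w : ℂ) :
    ∃ U ∈ Matrix.unitaryGroup n ℂ, U * A = A * U ∧ mpow A w = mpow A ((w.re : ℝ) : ℂ) * U := by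
  set u : ℝ → ℂ := fun x => if x = 0 then 1 else (x : ℂ) ^ (w.im * Complex.I) with hu
  refine ⟨hermFC A u, ?_, ?_, ?_⟩
  · rw [mem_unitaryGroup_iff, star_eq_conjTranspose, hermFC_conjTranspose hA.1, hermFC_mul hA.1,
      ← hermFC_one hA.1]
    refine hermFC_congr hA.1 fun i => ?_
    have h : ‖u (hA.1.eigenvalues i)‖ = 1 := by
      simp only [hu]
      split_ifs with h
      · exact norm_one
      · rw [Complex.norm_cpow_eq_rpow_re_of_pos ((hA.eigenvalues_nonneg i).lt_of_ne' h)]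
        simp
    have h2 := RCLike.mul_conj (u (hA.1.eigenvalues i))
    rw [h] at h2
    simpa using h2
  · conv_lhs =>
      enter [2]
      rw [← hermFC_ofReal hA.1]
    conv_rhs =>
      enter [1]
      rw [← hermFC_ofReal hA.1]
    rw [hermFC_mul hA.1, hermFC_mul hA.1]
    simp only [mul_comm]
  · rw [mpow, mpow, hermFC_mul hA.1]
    refine hermFC_congr hA.1 fun i => ?_
    simp only [hu]
    split_ifs with h
    · simp
    · rw [← Complex.cpow_add _ _ (Complex.ofReal_ne_zero.2 h), Complex.re_add_im]

lemma bddAbove_schattenNorm_chain {L : ℕ} {C : Fin L → Matrix n n ℂ}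
    (hC : ∀ i, (C i).PosSemidef) {q : ℝ} (hq : 0 < q) :
    BddAbove {x : ℝ | ∃ W : Fin L → Matrix n n ℂ,
        (∀ i, W i ∈ Matrix.unitaryGroup n ℂ ∧ W i * C i = C i * W i) ∧
        x = schattenNorm q
          ((List.ofFn fun i => mpow (C i) ((1 / q : ℝ) : ℂ) * W i).prod) ^ q} := by
  choose B hB0 hB using fun i => exists_l2_opNorm_mpow_le (hC i) (1 / q)
  refine ⟨∑ _i : n, ((∏ i, B i) * ∏ i, B i) ^ (q / 2), ?_⟩
  rintro x ⟨W, hW, rfl⟩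
  rw [schattenNorm_rpow hq]
  set X := (List.ofFn fun i => mpow (C i) ((1 / q : ℝ) : ℂ) * W i).prod
  have hX : ‖X‖ ≤ ∏ i, B i := by
    refine l2_opNorm_prod_ofFn_le _ _ fun i => (norm_mul_le _ _).trans ?_
    refine (mul_le_mul (hB i _ (by rw [Complex.ofReal_re]; positivity) le_rfl)
      (l2_opNorm_le_one_of_mem_unitaryGroup (hW i).1) (norm_nonneg _) (hB0 i)).trans ?_
    rw [mul_one]
  refine Finset.sum_le_sum fun i _ => ?_
  refine Real.rpow_le_rpow (eigenvalues_conjTranspose_mul_self_nonneg X i) ?_ (by positivity)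
  refine (le_abs_self _).trans ((norm_eigenvalues_le_l2_opNorm _ i).trans ?_)
  rw [l2_opNorm_conjTranspose_mul_self]
  exact mul_le_mul hX hX (norm_nonneg _) ((norm_nonneg _).trans hX)

/-- Complex interpolation: a uniform bound on the chain at exponent `q` passes to `p ≥ q`. -/
lemma schattenNorm_chain_le {L : ℕ} {C : Fin L → Matrix n n ℂ}
    (hC : ∀ i, (C i).PosSemidef) {p q S : ℝ} (hq : 1 ≤ q) (hqp : q ≤ p) (hS : 0 < S)
    (hbound : ∀ W : Fin L → Matrix n n ℂ,
      (∀ i, W i ∈ Matrix.unitaryGroup n ℂ ∧ W i * C i = C i * W i) →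
      schattenNorm q ((List.ofFn fun i => mpow (C i) ((1 / q : ℝ) : ℂ) * W i).prod) ^ q ≤ S)
    {V : Fin L → Matrix n n ℂ}
    (hV : ∀ i, V i ∈ Matrix.unitaryGroup n ℂ ∧ V i * C i = C i * V i) :
    schattenNorm p ((List.ofFn fun i => mpow (C i) ((1 / p : ℝ) : ℂ) * V i).prod) ^ p ≤ S := by
  have hq0 : 0 < q := by linarith
  have hp0 : 0 < p := by linarith
  have hq1 : 0 ≤ 1 - 1 / q := by
    rw [sub_nonneg, div_le_one hq0]; exact hq
  have hVn i : ‖V i‖ ≤ 1 := l2_opNorm_le_one_of_mem_unitaryGroup (hV i).1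
  set X := (List.ofFn fun i => mpow (C i) ((1 / p : ℝ) : ℂ) * V i).prod with hX
  have hTeq := schattenNorm_rpow hp0 X
  set T := schattenNorm p X ^ p
  clear_value T
  by_contra! hST
  have hT : 0 < T := hS.trans hST
  obtain ⟨K, hK, hKX, -⟩ := exists_polar X
  have hApos : (Xᴴ * X).PosSemidef := posSemidef_conjTranspose_mul_self X
  have hA := isHermitian_conjTranspose_mul_self X
  have hpos := eigenvalues_conjTranspose_mul_self_nonneg X
  set A := Xᴴ * X
  set G : ℂ → Matrix n n ℂ := fun z => (List.ofFn fun i => mpow (C i) (z / q) * V i).prod with hG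
  set e : ℂ → ℂ := fun z => (p / 2 : ℝ) * (1 - z / q) with he
  have here z : (e z).re = p / 2 * (1 - z.re / q) := by
    simp only [he]
    rw [Complex.re_ofReal_mul, Complex.sub_re, Complex.one_re, Complex.div_ofReal_re]
  set F : ℂ → ℂ := fun z => (mpow A (e z) * K * G z).trace with hF
  have hFX : F ((q / p : ℝ) : ℂ) = T := by
    have h1 : (((q / p : ℝ) : ℂ) / q) = ((1 / p : ℝ) : ℂ) := by
      rw [← Complex.ofReal_div]
      congr 1
      field_simp
    simp only [hF, hG, he, h1]
    rw [← hX, Matrix.mul_assoc, hKX, mpow, hermFC_mul hA, trace_hermFC hA, hTeq,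
      Complex.ofReal_sum]
    refine Finset.sum_congr rfl fun i _ => ?_
    split_ifs with h
    · rw [zero_mul, h, Real.zero_rpow (by positivity), Complex.ofReal_zero]
    · have hi := (hpos i).lt_of_ne' h
      rw [← Complex.ofReal_one, ← Complex.ofReal_sub, ← Complex.ofReal_mul,
        ← Complex.ofReal_cpow hi.le, ← Complex.ofReal_mul, Real.sqrt_eq_rpow, ← Real.rpow_add hi]
      congr 2
      field_simp
      ring
  have hFdiff : Differentiable ℂ F := by
    have hGd : Differentiable ℂ G := differentiable_prod_ofFn _ fun i =>
      (mpow_differentiable (hC i).1 (differentiable_id.div_const _)).mul_const _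
    have hM : Differentiable ℂ fun z => mpow A (e z) * K * G z :=
      ((mpow_differentiable hA (((differentiable_const _).sub
        (differentiable_id.div_const _)).const_mul _)).mul_const K).mul hGd
    exact (LinearMap.toContinuousLinearMap (Matrix.traceLinearMap n ℂ ℂ)).differentiable.comp hM
  have hFbdd : BddAbove ((norm ∘ F) '' Complex.HadamardThreeLines.verticalClosedStrip 0 1) := by
    choose B hB0 hB using fun i => exists_l2_opNorm_mpow_le (hC i) (1 / q)
    obtain ⟨D, hD0, hD⟩ := exists_l2_opNorm_mpow_le hApos (p / 2)
    refine ⟨Fintype.card n * (D * 1 * ∏ i, B i), ?_⟩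
    rintro _ ⟨z, ⟨hz0, hz1⟩, rfl⟩
    have hzq0 : 0 ≤ z.re / q := by positivity
    have hzq1 : z.re / q ≤ 1 / q := by gcongr
    refine (norm_trace_le_l2_opNorm _).trans ?_
    gcongr
    refine norm_mul₃_le.trans ?_
    gcongr
    · refine hD _ ?_ ?_
      · rw [here]
        exact mul_nonneg (by positivity) (by linarith)
      · rw [here]
        exact mul_le_of_le_one_right (by positivity) (by linarith)
    · refine l2_opNorm_prod_ofFn_le _ _ fun i => (norm_mul_le _ _).trans ?_
      refine (mul_le_mul (hB i _ ?_ ?_) (hVn i) (norm_nonneg _) (hB0 i)).trans_eq (mul_one _)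
      · rwa [Complex.div_ofReal_re]
      · rwa [Complex.div_ofReal_re]
  have hleft : ∀ z ∈ Complex.re ⁻¹' {(0 : ℝ)}, ‖F z‖ ≤ T := by
    intro z hz
    rw [Set.mem_preimage, Set.mem_singleton_iff] at hz
    have hGz : ‖G z‖ ≤ 1 := by
      refine (l2_opNorm_prod_ofFn_le _ (fun _ => 1) fun i => ?_).trans_eq (by simp)
      refine l2_opNorm_mul_le_one ?_ (hVn i)
      refine l2_opNorm_hermFC_le (hC i).1 zero_le_one fun j => ?_
      refine (norm_ite_cpow_le ((hC i).eigenvalues_nonneg j) _).trans_eq ?_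
      rw [Complex.div_ofReal_re, hz, zero_div, Real.rpow_zero]
    simp only [hF]
    rw [Matrix.mul_assoc, hTeq]
    refine (norm_trace_hermFC_mul_le hA _ (l2_opNorm_mul_le_one hK hGz)).trans ?_
    refine Finset.sum_le_sum fun i _ => (norm_ite_cpow_le (hpos i) _).trans_eq ?_
    rw [here, hz, zero_div, sub_zero, mul_one]
  have hright : ∀ z ∈ Complex.re ⁻¹' {(1 : ℝ)}, ‖F z‖ ≤ T ^ (1 - 1 / q) * S ^ (1 / q) := by
    intro z hz
    rw [Set.mem_preimage, Set.mem_singleton_iff] at hz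
    refine norm_trace_hermFC_mul_mul_le_rpow hA _ hK hq
      (fun i => Real.rpow_nonneg (hpos i) (p / 2)) hT hTeq.ge (fun i => ?_) hS ?_
    · refine (norm_ite_cpow_le (hpos i) _).trans_eq ?_
      rw [here, hz, Real.rpow_mul (hpos i)]
    · choose U hU hUC hUeq using fun i => exists_mpow_eq_mul_unitary (hC i) (z / q)
      have hGz : G z = (List.ofFn fun i => mpow (C i) ((1 / q : ℝ) : ℂ) * (U i * V i)).prod := by
        simp only [hG, hUeq, Complex.div_ofReal_re, hz, Matrix.mul_assoc]
      rw [hGz]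
      refine hbound _ fun i => ⟨mul_mem (hU i) (hV i).1, ?_⟩
      rw [Matrix.mul_assoc, (hV i).2, ← Matrix.mul_assoc, hUC, Matrix.mul_assoc]
  have key := Complex.HadamardThreeLines.norm_le_interp_of_mem_verticalClosedStrip' zero_lt_one
    (z := ((q / p : ℝ) : ℂ)) ⟨by rw [Complex.ofReal_re]; positivity,
      by rw [Complex.ofReal_re]; exact (div_le_one hp0).2 hqp⟩ hFdiff.diffContOnCl hFbdd
    hleft hright
  rw [hFX, Complex.norm_real, Real.norm_of_nonneg hT.le, Complex.ofReal_re, sub_zero, sub_zero,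
    div_one] at key
  have hlog := Real.log_le_log hT key
  rw [Real.log_mul (by positivity) (by positivity), Real.log_rpow hT, Real.log_rpow (by positivity),
    Real.log_mul (by positivity) (by positivity), Real.log_rpow hT, Real.log_rpow hS] at hlog
  have h2 : q / p * (1 / q) * (Real.log T - Real.log S) ≤ 0 := by linarith
  have h3 : 0 < q / p * (1 / q) * (Real.log T - Real.log S) :=
    mul_pos (by positivity) (sub_pos.2 (Real.log_lt_log hS hST))
  exact h2.not_gt h3

end PowerChain

/-- For positive semi-definite matrices `C₁, …, C_L`, unitaries `V_{C_i}`
commuting with `C_i`, and reals `1 ≤ q ≤ p`, the maximum of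
`‖C₁^{1/p} V_{C₁} ⋯ C_L^{1/p} V_{C_L}‖_p^p` over such unitaries is monotone
non-increasing in `p`. -/
theorem max_schatten_p_power_chain_antitone
    {n : Type*} [Fintype n] [DecidableEq n] (L : ℕ)
    (C : Fin L → Matrix n n ℂ) (hC : ∀ i, (C i).PosSemidef)
    (p q : ℝ) (hq : 1 ≤ q) (hqp : q ≤ p) :
    sSup {x : ℝ | ∃ V : Fin L → Matrix n n ℂ,
        (∀ i, V i ∈ Matrix.unitaryGroup n ℂ ∧ V i * C i = C i * V i) ∧
        x = schattenNorm p
          ((List.ofFn fun i => mpow (C i) ((1 / p : ℝ) : ℂ) * V i).prod) ^ p} ≤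
    sSup {x : ℝ | ∃ W : Fin L → Matrix n n ℂ,
        (∀ i, W i ∈ Matrix.unitaryGroup n ℂ ∧ W i * C i = C i * W i) ∧
        x = schattenNorm q
          ((List.ofFn fun i => mpow (C i) ((1 / q : ℝ) : ℂ) * W i).prod) ^ q} := by
  have hq0 : 0 < q := by linarith
  have hbdd := bddAbove_schattenNorm_chain hC hq0
  refine csSup_le ⟨_, fun _ => 1, fun i => ⟨one_mem _, by rw [Matrix.one_mul, Matrix.mul_one]⟩,
    rfl⟩ ?_
  rintro x ⟨V, hV, rfl⟩
  refine le_of_forall_gt_imp_ge_of_dense fun S hS => ?_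
  have hle : ∀ W : Fin L → Matrix n n ℂ,
      (∀ i, W i ∈ Matrix.unitaryGroup n ℂ ∧ W i * C i = C i * W i) →
      schattenNorm q ((List.ofFn fun i => mpow (C i) ((1 / q : ℝ) : ℂ) * W i).prod) ^ q ≤ S :=
    fun W hW => (le_csSup hbdd ⟨W, hW, rfl⟩).trans hS.le
  refine schattenNorm_chain_le hC hq hqp (lt_of_le_of_lt ?_ hS) hle hV
  refine Real.sSup_nonneg ?_
  rintro x ⟨W, -, rfl⟩
  rw [schattenNorm_rpow hq0]
  exact Finset.sum_nonneg fun i _ =>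
    Real.rpow_nonneg (eigenvalues_conjTranspose_mul_self_nonneg _ i) _
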